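/- arXiv:0904.1331 — 3 statements merged into one kernel-verified Lean document; each statement's English description precedes it below -/
import Mathlib

section
/- Let q be a prime power and n ≥ 1. Any two Singer subgroups of GL_n(𝔽_q), i.e., any two cyclic subgroups of GL_n(𝔽_q) of order q^n − 1, are conjugate in GL_n(𝔽_q). -/
open Matrix

lemma singer_card_le {F : Type*} [Field F] [Fintype F] (n : ℕ) (A : Matrix (Fin n) (Fin n) F) :
    Nat.card (Algebra.adjoin F {A}) ≤ Fintype.card F ^ n := by
  have hc : Nat.card (Fin n → F) = Fintype.card F ^ n := by simp
  rw [← hc]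
  let f : (Fin n → F) → Algebra.adjoin F {A} := fun c =>
    ⟨Polynomial.aeval A ((Polynomial.degreeLTEquiv F n).symm c : Polynomial F),
      Polynomial.aeval_mem_adjoin_singleton F A⟩
  apply Nat.card_le_card_of_surjective f
  rintro ⟨M, hM⟩
  have hM' := hM
  rw [Algebra.adjoin_singleton_eq_range_aeval] at hM'
  obtain ⟨p, rfl⟩ := hM'
  have hd : p %ₘ A.charpoly ∈ Polynomial.degreeLT F n := by
    rw [Polynomial.mem_degreeLT]
    have := Polynomial.degree_modByMonic_lt p A.charpoly_monic
    rwa [Matrix.charpoly_degree_eq_dim, Fintype.card_fin] at this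
  refine ⟨Polynomial.degreeLTEquiv F n ⟨_, hd⟩, ?_⟩
  apply Subtype.ext
  simp only [f, LinearEquiv.symm_apply_apply]
  exact Polynomial.aeval_modByMonic_eq_self_of_root (Matrix.aeval_self_charpoly A)

lemma singer_field {F : Type*} [Field F] [Fintype F] (n : ℕ) (hn : 1 ≤ n)
    (H : Subgroup (GL (Fin n) F))
    (hHc : IsCyclic H) (hHcard : Nat.card H = Fintype.card F ^ n - 1) :
    ∃ S : Subalgebra F (Matrix (Fin n) (Fin n) F),
      (∀ h ∈ H, (h : Matrix (Fin n) (Fin n) F) ∈ S) ∧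
      (∀ M ∈ S, M ≠ 0 → ∃ h ∈ H, (h : Matrix (Fin n) (Fin n) F) = M) ∧
      IsField S ∧ Nat.card S = Fintype.card F ^ n := by
  classical
  have : Nonempty (Fin n) := ⟨⟨0, hn⟩⟩
  obtain ⟨⟨a, ha⟩, hgen⟩ := hHc.exists_generator
  have hpow : ∀ h ∈ H, ∃ k : ℕ, a ^ k = h := by
    intro h hh
    have h1 := hgen ⟨h, hh⟩
    rw [← mem_powers_iff_mem_zpowers] at h1
    obtain ⟨k, hk⟩ := h1
    exact ⟨k, congrArg Subtype.val hk⟩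
  let A : Matrix (Fin n) (Fin n) F := a
  have hmem : ∀ h ∈ H, (h : Matrix (Fin n) (Fin n) F) ∈ Algebra.adjoin F {A} := by
    intro h hh
    obtain ⟨k, rfl⟩ := hpow h hh
    rw [Units.val_pow_eq_pow_val]
    exact Subalgebra.pow_mem _ (Algebra.self_mem_adjoin_singleton F A) k
  have hq : 1 ≤ Fintype.card F ^ n := Nat.one_le_pow _ _ Fintype.card_pos
  let f : Option H → Algebra.adjoin F {A} := fun o =>
    o.elim 0 (fun h => ⟨(h.1 : Matrix (Fin n) (Fin n) F), hmem h.1 h.2⟩)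
  have hne : ∀ h : GL (Fin n) F, (h : Matrix (Fin n) (Fin n) F) ≠ 0 := fun h => h.ne_zero
  have hinj : Function.Injective f := by
    rintro (_ | h) (_ | k) hk
    · rfl
    · exact absurd (congrArg Subtype.val hk).symm (hne k.1)
    · exact absurd (congrArg Subtype.val hk) (hne h.1)
    · exact congrArg some (Subtype.ext (Units.ext (congrArg Subtype.val hk)))
  have hcO : Nat.card (Option H) = Fintype.card F ^ n := by
    rw [Finite.card_option, hHcard]; omega
  have hle := singer_card_le n A
  have hge := Nat.card_le_card_of_injective f hinj
  have hcS : Nat.card (Algebra.adjoin F {A}) = Fintype.card F ^ n := by omega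
  have hbij : Function.Bijective f :=
    (Nat.bijective_iff_injective_and_card f).2 ⟨hinj, by rw [hcO, hcS]⟩
  have hsurj : ∀ M ∈ Algebra.adjoin F {A}, M ≠ 0 →
      ∃ h ∈ H, (h : Matrix (Fin n) (Fin n) F) = M := by
    intro M hM h0
    obtain ⟨o, ho⟩ := hbij.2 ⟨M, hM⟩
    rcases o with _ | h
    · exact absurd (congrArg Subtype.val ho).symm h0
    · exact ⟨h.1, h.2, congrArg Subtype.val ho⟩
  refine ⟨Algebra.adjoin F {A}, hmem, hsurj, ⟨?_, ?_, ?_⟩, hcS⟩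
  · exact ⟨0, 1, zero_ne_one⟩
  · rintro x y
    exact (Algebra.isMulCommutative_adjoin F (s := {A}) (by simp)).is_comm.comm x y
  · rintro ⟨M, hM⟩ h0
    obtain ⟨h, hh, rfl⟩ := hsurj M hM (fun h => h0 (Subtype.ext h))
    exact ⟨⟨_, hmem h⁻¹ (H.inv_mem hh)⟩, Subtype.ext (by simp)⟩

lemma singer_equiv {F : Type*} [Field F] [Fintype F] {R : Type*} [Ring R] [Algebra F R] [Finite R]
    (S T : Subalgebra F R) (hS : IsField S) (hT : IsField T) (h : Nat.card S = Nat.card T) :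
    Nonempty (S ≃ₐ[F] T) := by
  let fS : Field S := hS.toField
  let fT : Field T := hT.toField
  let aS : @Algebra F S _ fS.toSemifield.toDivisionSemiring.toSemiring := S.algebra
  let aT : @Algebra F T _ fT.toSemifield.toDivisionSemiring.toSemiring := T.algebra
  have hfr : Module.finrank F S = Module.finrank F T := by
    rw [Module.natCard_eq_pow_finrank (K := F), Module.natCard_eq_pow_finrank (K := F) (V := T)] at h
    exact Nat.pow_right_injective (Finite.one_lt_card (α := F)) h
  obtain ⟨f⟩ : Nonempty (S →ₐ[F] T) :=
    FiniteField.nonempty_algHom_of_finrank_dvd (F := F) (K := S) (L := T) (dvd_of_eq hfr)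
  have hinj : Function.Injective f := f.toRingHom.injective
  exact ⟨AlgEquiv.ofBijective f ((Nat.bijective_iff_injective_and_card f).2 ⟨hinj, h⟩)⟩

lemma singer_vec {F : Type*} [Field F] [Fintype F] (n : ℕ)
    (S : Subalgebra F (Matrix (Fin n) (Fin n) F)) (hS : IsField S)
    (hc : Nat.card S = Fintype.card F ^ n) (v : Fin n → F) (hv : v ≠ 0) :
    ∃ e : S ≃ₗ[F] (Fin n → F), ∀ x, e x = x.1 *ᵥ v := by
  let f : S →ₗ[F] (Fin n → F) :=
    { toFun := fun x => x.1 *ᵥ v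
      map_add' := fun x y => by simp [Matrix.add_mulVec]
      map_smul' := fun c x => by simp [Matrix.smul_mulVec] }
  have hinj : Function.Injective f := by
    rw [injective_iff_map_eq_zero]
    intro x hx
    by_contra h0
    obtain ⟨y, hy⟩ := hS.mul_inv_cancel h0
    rw [hS.mul_comm] at hy
    apply hv
    have h1 : y.1 * x.1 = 1 := congrArg Subtype.val hy
    calc v = (y.1 * x.1) *ᵥ v := by rw [h1, Matrix.one_mulVec]
      _ = y.1 *ᵥ (x.1 *ᵥ v) := by rw [Matrix.mulVec_mulVec]
      _ = 0 := by
        rw [show x.1 *ᵥ v = 0 from hx, Matrix.mulVec_zero]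
  have hb : Function.Bijective f :=
    (Nat.bijective_iff_injective_and_card f).2 ⟨hinj, by rw [hc]; simp⟩
  exact ⟨LinearEquiv.ofBijective f hb, fun x => rfl⟩

/-- Any two Singer subgroups (cyclic subgroups of order `q^n - 1`) of `GL_n(𝔽_q)`
are conjugate. -/
theorem stmt_8 {F : Type*} [Field F] [Fintype F] (n : ℕ) (hn : 1 ≤ n)
    (H K : Subgroup (GL (Fin n) F))
    (hHc : IsCyclic H) (hHcard : Nat.card H = Fintype.card F ^ n - 1)
    (hKc : IsCyclic K) (hKcard : Nat.card K = Fintype.card F ^ n - 1) :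
    ∃ g : GL (Fin n) F, Subgroup.map (MulAut.conj g).toMonoidHom H = K := by
  classical
  have : Nonempty (Fin n) := ⟨⟨0, hn⟩⟩
  obtain ⟨S, hHS, -, hSf, hSc⟩ := singer_field n hn H hHc hHcard
  obtain ⟨T, -, hTK, hTf, hTc⟩ := singer_field n hn K hKc hKcard
  obtain ⟨φ⟩ := singer_equiv S T hSf hTf (by rw [hSc, hTc])
  obtain ⟨v, hv⟩ := exists_ne (0 : Fin n → F)
  obtain ⟨e, he⟩ := singer_vec n S hSf hSc v hv
  obtain ⟨d, hd⟩ := singer_vec n T hTf hTc v hv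
  let L : (Fin n → F) ≃ₗ[F] (Fin n → F) := (e.symm.trans φ.toLinearEquiv).trans d
  let g : GL (Fin n) F :=
    ⟨LinearMap.toMatrix' L.toLinearMap, LinearMap.toMatrix' L.symm.toLinearMap,
      by rw [← LinearMap.toMatrix'_comp]; simp, by rw [← LinearMap.toMatrix'_comp]; simp⟩
  have hg : ∀ w, (g : Matrix (Fin n) (Fin n) F) *ᵥ w = L w := fun w =>
    LinearMap.toMatrix'_mulVec _ _
  have key : ∀ x : S, (g : Matrix (Fin n) (Fin n) F) * x.1 = (φ x).1 * g := by
    intro x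
    apply Matrix.toLin'.injective
    apply LinearMap.ext
    intro w
    simp only [Matrix.toLin'_apply, ← Matrix.mulVec_mulVec, hg]
    obtain ⟨y, rfl⟩ := e.surjective w
    have h1 : x.1 *ᵥ e y = e (x * y) := by
      rw [he, he, Matrix.mulVec_mulVec]; rfl
    rw [h1]
    simp only [L, LinearEquiv.trans_apply, LinearEquiv.symm_apply_apply,
      AlgEquiv.toLinearEquiv_apply, map_mul, hd, Matrix.mulVec_mulVec]
    rfl
  refine ⟨g, Subgroup.eq_of_le_of_card_ge ?_ ?_⟩
  · rintro _ ⟨h, hh, rfl⟩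
    have hk := key ⟨_, hHS h hh⟩
    set M := (φ ⟨_, hHS h hh⟩).1 with hM
    have hM' : M = ((g * h * g⁻¹ : GL (Fin n) F) : Matrix (Fin n) (Fin n) F) := by
      rw [Units.val_mul, Units.val_mul, hk, mul_assoc, Units.mul_inv, mul_one]
    obtain ⟨k, hkK, hkM⟩ := hTK M (φ _).2 (hM' ▸ Units.ne_zero _)
    have : k = g * h * g⁻¹ := Units.ext (hkM.trans hM')
    simpa [MulAut.conj_apply, ← this] using hkK
  · rw [hKcard, ← hHcard]
    exact (Nat.card_congr (H.equivMapOfInjective _ (MulAut.conj g).injective).toEquiv).le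
end

section
/- Let q be a prime power and n ≥ 1. The number of Singer subgroups of GL_n(𝔽_q), i.e., of cyclic subgroups of GL_n(𝔽_q) of order q^n − 1, equals |GL_n(𝔽_q)| / (n(q^n − 1)). -/
open Matrix

section
open Module
variable {F : Type*} [Field F] [Fintype F] {K : Type} [Field K] [Finite K] [Algebra F K] {n : ℕ}

lemma card_mul_aux (hK : finrank F K = n) (hn : 1 ≤ n) :
    Nat.card (K →ₐ[F] Matrix (Fin n) (Fin n) F) * (Fintype.card F ^ n - 1) =
      Nat.card (GL (Fin n) F) := by
  classical
  have hfr : finrank F K = finrank F (Fin n → F) := by simp [hK]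
  have : FiniteDimensional F K := Module.Finite.of_finite
  have : Nonempty (Fin n) := ⟨⟨0, hn⟩⟩
  have h1 : Nat.card {v : Fin n → F // v ≠ 0} = Fintype.card F ^ n - 1 := by
    rw [Nat.card_eq_fintype_card, Fintype.card_subtype_compl]
    simp
  let e0 : K ≃ₗ[F] (Fin n → F) := LinearEquiv.ofFinrankEq _ _ hfr
  have h2 : Nat.card (GL (Fin n) F) = Nat.card (K ≃ₗ[F] (Fin n → F)) := by
    refine Nat.card_congr ?_
    refine (Matrix.GeneralLinearGroup.toLin.toEquiv.trans
      (LinearMap.GeneralLinearGroup.generalLinearEquiv F (Fin n → F)).toEquiv).trans ?_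
    exact ⟨fun f => e0.trans f, fun f => e0.symm.trans f, fun f => by ext; simp,
      fun f => by ext; simp⟩
  rw [h2, ← h1, ← Nat.card_prod]
  let f : (K →ₐ[F] Matrix (Fin n) (Fin n) F) × {v : Fin n → F // v ≠ 0} → (K →ₗ[F] (Fin n → F)) :=
    fun p => 
      { toFun := fun k => p.1 k *ᵥ p.2.1
        map_add' := fun a b => by rw [map_add, Matrix.add_mulVec]
        map_smul' := fun a b => by rw [map_smul, Matrix.smul_mulVec]; rfl }
  have hf : ∀ p, Function.Injective (f p) := by
    intro p
    rw [injective_iff_map_eq_zero]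
    intro k hk
    by_contra hk0
    apply p.2.2
    have : p.1 (k⁻¹ * k) *ᵥ p.2.1 = 0 := by
      rw [map_mul, ← Matrix.mulVec_mulVec]
      change p.1 k⁻¹ *ᵥ (f p k) = 0
      rw [hk, Matrix.mulVec_zero]
    rwa [inv_mul_cancel₀ hk0, map_one, Matrix.one_mulVec] at this
  refine Nat.card_congr (Equiv.ofBijective
    (fun p => LinearEquiv.ofInjectiveOfFinrankEq (f p) (hf p) hfr) ⟨?_, ?_⟩)
  · rintro p p' h
    have hh : ∀ k, p.1 k *ᵥ p.2.1 = p'.1 k *ᵥ p'.2.1 := fun k => by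
      have := congrArg (fun e => e k) h
      exact this
    have hv : p.2.1 = p'.2.1 := by simpa using hh 1
    refine Prod.ext (AlgHom.ext fun k => ?_) (Subtype.ext hv)
    apply Matrix.mulVec_injective
    funext w
    obtain ⟨y, rfl⟩ := (LinearEquiv.ofInjectiveOfFinrankEq (f p) (hf p) hfr).surjective w
    change p.1 k *ᵥ (p.1 y *ᵥ p.2.1) = p'.1 k *ᵥ (p.1 y *ᵥ p.2.1)
    nth_rewrite 2 [hh y]
    rw [Matrix.mulVec_mulVec, Matrix.mulVec_mulVec, ← map_mul, ← map_mul, hh]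
  · intro e
    refine ⟨⟨(Matrix.toLinAlgEquiv'.symm.toAlgHom.comp
      (e.conjAlgEquiv F).toAlgHom).comp (Algebra.lmul F K), ⟨e 1, by simp⟩⟩, ?_⟩
    ext1 k
    change (LinearMap.toMatrixAlgEquiv' _) *ᵥ (e 1) = e k
    rw [← Matrix.toLinAlgEquiv'_apply, Matrix.toLinAlgEquiv'_toMatrixAlgEquiv']
    simp [LinearEquiv.conjAlgEquiv]

lemma fiber_aux (φ : K →ₐ[F] Matrix (Fin n) (Fin n) F) [Nonempty (Fin n)] (hK : finrank F K = n) :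
    Nat.card {ψ : K →ₐ[F] Matrix (Fin n) (Fin n) F //
      (Units.map (ψ : K →* Matrix (Fin n) (Fin n) F)).range
        = (Units.map (φ : K →* Matrix (Fin n) (Fin n) F)).range} = n := by
  classical
  have : FiniteDimensional F K := Module.Finite.of_finite
  have hφ : Function.Injective φ := φ.toRingHom.injective
  conv_rhs => rw [← hK, ← IsGalois.card_aut_eq_finrank F K]
  symm
  have key : ∀ ψ₁ ψ₂ : K →ₐ[F] Matrix (Fin n) (Fin n) F, 
      (∀ k, ∃ k', ψ₁ k = ψ₂ k') → (Units.map (ψ₁ : K →* Matrix (Fin n) (Fin n) F)).range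
        ≤ (Units.map (ψ₂ : K →* Matrix (Fin n) (Fin n) F)).range := by
    rintro ψ₁ ψ₂ h _ ⟨u, rfl⟩
    obtain ⟨k', hk'⟩ := h u
    have hk0 : k' ≠ 0 := by
      rintro rfl
      rw [map_zero] at hk'
      exact u.ne_zero (ψ₁.toRingHom.injective (hk'.trans (map_zero _).symm))
    refine ⟨Units.mk0 k' hk0, Units.ext hk'.symm⟩
  refine Nat.card_congr (Equiv.ofBijective (fun σ : K ≃ₐ[F] K => ⟨φ.comp σ.toAlgHom, ?_⟩) ⟨?_, ?_⟩)
  · apply le_antisymm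
    · exact key _ _ fun k => ⟨σ k, rfl⟩
    · exact key _ _ fun k => ⟨σ.symm k, by simp⟩
  · intro σ τ h
    ext k
    have := congrArg (fun e => e.1 k) h
    exact hφ this
  · rintro ⟨ψ, hψ⟩
    have hr : ∀ k, ψ k ∈ φ.range := by
      intro k
      by_cases hk : k = 0
      · subst hk; rw [map_zero]; exact zero_mem _
      · have : Units.map (ψ : K →* Matrix (Fin n) (Fin n) F) (Units.mk0 k hk) ∈
          (Units.map (φ : K →* Matrix (Fin n) (Fin n) F)).range := hψ ▸ ⟨_, rfl⟩
        obtain ⟨u, hu⟩ := this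
        exact ⟨u, congrArg Units.val hu⟩
    let σ : K →ₐ[F] K := (AlgEquiv.ofInjective φ hφ).symm.toAlgHom.comp (ψ.codRestrict φ.range hr)
    have hσ : ∀ k, φ (σ k) = ψ k := fun k => 
      congrArg Subtype.val ((AlgEquiv.ofInjective φ hφ).apply_symm_apply (ψ.codRestrict φ.range hr k))
    refine ⟨AlgEquiv.ofBijective σ (Finite.injective_iff_bijective.1 σ.toRingHom.injective), ?_⟩
    apply Subtype.ext
    ext1 k
    exact hσ k

lemma algEquiv_aux {B : Type*} [CommRing B] [Algebra F B] (hB : IsField B)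
    (hK : finrank F K = n) (hn : 1 ≤ n) (hfB : finrank F B = n) : Nonempty (K ≃ₐ[F] B) := by
  let : Field B := hB.toField
  obtain ⟨p, hp⟩ := CharP.exists F
  have : Fact p.Prime := ⟨CharP.char_is_prime F p⟩
  have : NeZero n := ⟨by omega⟩
  have : FiniteDimensional F B := FiniteDimensional.of_finrank_pos (by omega)
  have e1 := FiniteField.algEquivExtension F p n K hK
  have e2 := FiniteField.algEquivExtension F p n B hfB
  exact ⟨e1.trans e2.symm⟩

lemma surj_aux (hK : finrank F K = n) (hn : 1 ≤ n) (g : GL (Fin n) F)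
    (hg : orderOf g = Fintype.card F ^ n - 1) :
    ∃ φ : K →ₐ[F] Matrix (Fin n) (Fin n) F,
      Subgroup.zpowers g ≤ (Units.map (φ : K →* Matrix (Fin n) (Fin n) F)).range := by
  classical
  have : Nonempty (Fin n) := ⟨⟨0, hn⟩⟩
  set c := g.1.charpoly with hc
  have hcm : c.Monic := g.1.charpoly_monic
  have hq : 1 < Fintype.card F := Fintype.one_lt_card
  have hqn : 1 < Fintype.card F ^ n := Nat.one_lt_pow (by omega) hq
  set N := Fintype.card F ^ n - 1 with hN
  let pb := AdjoinRoot.powerBasis' hcm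
  have hfB : finrank F (AdjoinRoot c) = n := by
    rw [pb.finrank, AdjoinRoot.powerBasis'_dim, hc, Matrix.charpoly_natDegree_eq_dim]; simp
  have : FiniteDimensional F (AdjoinRoot c) := pb.finite
  have : Finite (AdjoinRoot c) := Module.finite_of_finite F
  have := Fintype.ofFinite (AdjoinRoot c)
  have hcard : Fintype.card (AdjoinRoot c) = Fintype.card F ^ n := by
    rw [Module.card_eq_pow_finrank (K := F), hfB]
  let ψ : AdjoinRoot c →ₐ[F] Matrix (Fin n) (Fin n) F :=
    Ideal.Quotient.liftₐ (Ideal.span {c}) (Polynomial.aeval g.1) (by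
      intro a ha
      obtain ⟨b, rfl⟩ := Ideal.mem_span_singleton.1 ha
      rw [map_mul, hc, Matrix.aeval_self_charpoly, zero_mul])
  have hψ : ψ (AdjoinRoot.root c) = g.1 := by
    change Polynomial.aeval g.1 Polynomial.X = g.1
    simp
  have hψp : ∀ i : ℕ, ψ (AdjoinRoot.root c ^ i) = (g ^ i : GL (Fin n) F).1 := fun i => by
    rw [map_pow, hψ, Units.val_pow_eq_pow_val]
  have hne : ∀ i : ℕ, AdjoinRoot.root c ^ i ≠ 0 := fun i h => by
    have := hψp i
    rw [h, map_zero] at this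
    exact (g ^ i).ne_zero this.symm
  let P : Fin N → {y : AdjoinRoot c // y ≠ 0} := fun i => ⟨AdjoinRoot.root c ^ (i : ℕ), hne i⟩
  have hP : Function.Bijective P := by
    rw [Fintype.bijective_iff_injective_and_card]
    constructor
    · intro i j hij
      have h1 : AdjoinRoot.root c ^ (i : ℕ) = AdjoinRoot.root c ^ (j : ℕ) :=
        congrArg Subtype.val hij
      have h2 : g ^ (i : ℕ) = g ^ (j : ℕ) := Units.ext (by rw [← hψp, ← hψp, h1])
      exact Fin.ext (pow_injOn_Iio_orderOf (by simp [hg]) (by simp [hg]) h2)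
    · rw [Fintype.card_subtype_compl, hcard]
      simp [hN]
  have hpow : ∀ y : AdjoinRoot c, y ≠ 0 → ∃ i < N, y = AdjoinRoot.root c ^ i := fun y hy => by
    obtain ⟨i, hi⟩ := hP.2 ⟨y, hy⟩
    exact ⟨i, i.2, (congrArg Subtype.val hi).symm⟩
  have hinj : Function.Injective ψ := by
    rw [injective_iff_map_eq_zero]
    intro y hy
    by_contra h0
    obtain ⟨i, -, rfl⟩ := hpow y h0
    rw [hψp] at hy
    exact (g ^ i).ne_zero hy
  have hroot : AdjoinRoot.root c ^ N = 1 := hinj (by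
    rw [hψp, map_one, ← hg, pow_orderOf_eq_one, Units.val_one])
  have hB : IsField (AdjoinRoot c) := by
    refine ⟨⟨0, 1, ?_⟩, mul_comm, ?_⟩
    · have := hne 0
      rw [pow_zero] at this
      exact this.symm
    · intro a ha
      obtain ⟨i, hi, rfl⟩ := hpow a ha
      exact ⟨AdjoinRoot.root c ^ (N - i), by rw [← pow_add, Nat.add_sub_cancel' hi.le, hroot]⟩
  obtain ⟨e⟩ := algEquiv_aux (K := K) hB hK hn hfB
  refine ⟨ψ.comp e.toAlgHom, ?_⟩
  rw [Subgroup.zpowers_le]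
  have h0 : e.symm (AdjoinRoot.root c) ≠ 0 := by
    rw [Ne, EmbeddingLike.map_eq_zero_iff]
    simpa using hne 1
  refine ⟨Units.mk0 _ h0, Units.ext ?_⟩
  change ψ (e (e.symm _)) = _
  rw [AlgEquiv.apply_symm_apply, hψ]

lemma range_aux (φ : K →ₐ[F] Matrix (Fin n) (Fin n) F) (hK : finrank F K = n) (hn : 1 ≤ n) :
    IsCyclic (Units.map (φ : K →* Matrix (Fin n) (Fin n) F)).range ∧
    Nat.card (Units.map (φ : K →* Matrix (Fin n) (Fin n) F)).range = Fintype.card F ^ n - 1 := by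
  have : Nonempty (Fin n) := ⟨⟨0, hn⟩⟩
  have hφ : Function.Injective φ := φ.toRingHom.injective
  have hi : Function.Injective (Units.map (φ : K →* Matrix (Fin n) (Fin n) F)) :=
    Units.map_injective hφ
  refine ⟨isCyclic_of_surjective _ (MonoidHom.ofInjective hi).surjective, ?_⟩
  have : FiniteDimensional F K := Module.Finite.of_finite
  rw [Nat.card_congr (MonoidHom.ofInjective hi).symm.toEquiv, Nat.card_units,
    Module.natCard_eq_pow_finrank (K := F), hK, Nat.card_eq_fintype_card]

lemma main_aux (hK : finrank F K = n) (hn : 1 ≤ n) :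
    Nat.card (K →ₐ[F] Matrix (Fin n) (Fin n) F) =
    Nat.card {H : Subgroup (GL (Fin n) F) //
        IsCyclic H ∧ Nat.card H = Fintype.card F ^ n - 1} * n := by
  classical
  have : Nonempty (Fin n) := ⟨⟨0, hn⟩⟩
  let f : (K →ₐ[F] Matrix (Fin n) (Fin n) F) → {H : Subgroup (GL (Fin n) F) //
        IsCyclic H ∧ Nat.card H = Fintype.card F ^ n - 1} :=
    fun φ => ⟨_, range_aux φ hK hn⟩
  have : Finite (K →ₐ[F] Matrix (Fin n) (Fin n) F) := DFunLike.finite _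
  have := Fintype.ofFinite {H : Subgroup (GL (Fin n) F) //
        IsCyclic H ∧ Nat.card H = Fintype.card F ^ n - 1}
  rw [← Nat.card_congr (Equiv.sigmaFiberEquiv f), Nat.card_sigma]
  have hfib : ∀ H, Nat.card {φ // f φ = H} = n := by
    rintro ⟨H, hc, hH⟩
    obtain ⟨g, hg⟩ := (Subgroup.isCyclic_iff_exists_zpowers_eq_top H).1 hc
    obtain ⟨φ, hφ⟩ := surj_aux (K := K) hK hn g (by rw [← Nat.card_zpowers, hg, hH])
    rw [hg] at hφ
    have heq : H = (Units.map (φ : K →* Matrix (Fin n) (Fin n) F)).range :=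
      Subgroup.eq_of_le_of_card_ge hφ (by rw [hH, (range_aux φ hK hn).2])
    subst heq
    refine Eq.trans ?_ (fiber_aux φ hK)
    exact Nat.card_congr (Equiv.subtypeEquivRight fun ψ => Subtype.ext_iff)
  simp [hfib, Nat.card_eq_fintype_card]

end

/-- The number of Singer subgroups (cyclic subgroups of order `q^n - 1`) of `GL_n(𝔽_q)`
equals `|GL_n(𝔽_q)| / (n (q^n - 1))`. -/
theorem stmt_10 {F : Type*} [Field F] [Fintype F] (n : ℕ) (hn : 1 ≤ n) :
    Nat.card {H : Subgroup (GL (Fin n) F) //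
        IsCyclic H ∧ Nat.card H = Fintype.card F ^ n - 1} =
      Nat.card (GL (Fin n) F) / (n * (Fintype.card F ^ n - 1)) := by
  obtain ⟨p, hp⟩ := CharP.exists F
  have : Fact p.Prime := ⟨CharP.char_is_prime F p⟩
  have : NeZero n := ⟨by omega⟩
  have hK := FiniteField.finrank_extension F p n
  have hqn : 1 < Fintype.card F ^ n := Nat.one_lt_pow (by omega) Fintype.one_lt_card
  rw [← card_mul_aux hK hn, main_aux hK hn, mul_assoc, Nat.mul_div_cancel]
  exact Nat.mul_pos hn (by omega)
end

section
/- Let q be a prime power and m ≥ 1. The number of Singer cycles in GL_m(𝔽_q), i.e., the number of elements of GL_m(𝔽_q) of order q^m − 1, equals (φ(q^m − 1)/m) · ∏_{i=1}^{m−1}(q^m − q^i), where φ is the Euler totient function. -/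
open Matrix

set_option linter.all false

namespace Singer

lemma dvd_totient (q m : ℕ) (hq : 2 ≤ q) (hm : 1 ≤ m) : m ∣ Nat.totient (q ^ m - 1) := by
  rcases Nat.lt_or_ge m 2 with h | h
  · obtain rfl : m = 1 := by omega
    exact one_dvd _
  have hqm : q < q ^ m := by
    calc q = q ^ 1 := (pow_one q).symm
      _ < q ^ m := Nat.pow_lt_pow_right (by omega) (by omega)
  have hN : NeZero (q ^ m - 1) := ⟨by omega⟩
  have h1 : (q : ZMod (q ^ m - 1)) ^ m = 1 := by
    have : ((q ^ m - 1 + 1 : ℕ) : ZMod (q ^ m - 1)) = 1 := by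
      rw [Nat.cast_add, ZMod.natCast_self]; simp
    rw [Nat.sub_add_cancel (by omega)] at this
    exact_mod_cast this
  have ho : orderOf (q : ZMod (q ^ m - 1)) = m := by
    rw [orderOf_eq_iff (by omega)]
    refine ⟨h1, fun k hk hk0 hc => ?_⟩
    have h2 : ((q ^ k : ℕ) : ZMod (q ^ m - 1)) = ((1 : ℕ) : ZMod (q ^ m - 1)) := by
      exact_mod_cast hc
    rw [ZMod.natCast_eq_natCast_iff] at h2
    have h3 : q ^ k * 2 ≤ q ^ m := by
      calc q ^ k * 2 ≤ q ^ k * q := Nat.mul_le_mul_left _ hq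
        _ = q ^ (k+1) := (pow_succ _ _).symm
        _ ≤ q ^ m := Nat.pow_le_pow_right (by omega) (by omega)
    have h4 : 2 ≤ q ^ k := le_trans hq (Nat.le_self_pow (by omega) q)
    have h5 := Nat.ModEq.eq_of_lt_of_lt h2 (by omega) (by omega)
    omega
  have hu : IsUnit (q : ZMod (q ^ m - 1)) := IsUnit.of_pow_eq_one h1 (by omega)
  obtain ⟨u, hu⟩ := hu
  rw [← hu, orderOf_units] at ho
  rw [← ZMod.card_units_eq_totient]
  have h6 := orderOf_dvd_card (x := u)
  rwa [ho] at h6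

section
variable {F K V : Type*} [Field F] [Fintype F] [Field K] [Finite K] [Algebra F K]
  [AddCommGroup V] [Module F V] [FiniteDimensional F V]

/-- evaluation map at a vector -/
noncomputable def evMap (f : K →ₐ[F] Module.End F V) (v : V) : K →ₗ[F] V :=
  (LinearMap.applyₗ v).comp f.toLinearMap

lemma evMap_apply (f : K →ₐ[F] Module.End F V) (v : V) (k : K) : evMap f v k = f k v := rfl

lemma evMap_inj (f : K →ₐ[F] Module.End F V) (v : V) (hv : v ≠ 0) :
    Function.Injective (evMap f v) := by
  rw [injective_iff_map_eq_zero]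
  intro k hk
  by_contra h
  apply hv
  have : f (k⁻¹ * k) v = 0 := by
    rw [map_mul, Module.End.mul_apply, ← evMap_apply f v k, hk, map_zero]
  rwa [inv_mul_cancel₀ h, map_one] at this

noncomputable def equiv1 (h : Module.finrank F K = Module.finrank F V) :
    (K ≃ₗ[F] V) ≃ (K →ₐ[F] Module.End F V) × {v : V // v ≠ 0} where
  toFun e := ⟨(e.conjAlgEquiv F).toAlgHom.comp (Algebra.lmul F K), ⟨e 1, by simp⟩⟩
  invFun p := haveI : FiniteDimensional F K := Module.Finite.of_finite
    LinearEquiv.ofInjectiveOfFinrankEq (evMap p.1 p.2.1) (evMap_inj _ _ p.2.2) h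
  left_inv e := by
    ext k
    change e (k * e.symm (e 1)) = e k
    simp
  right_inv p := by
    obtain ⟨f, v, hv⟩ := p
    haveI : FiniteDimensional F K := Module.Finite.of_finite
    set e := LinearEquiv.ofInjectiveOfFinrankEq (evMap f v) (evMap_inj _ _ hv) h with he
    have he' : ∀ k, e k = f k v := fun k => rfl
    refine Prod.ext ?_ ?_
    · ext k w
      obtain ⟨l, rfl⟩ := e.surjective w
      change e (k * e.symm (e l)) = f k (e l)
      rw [e.symm_apply_apply, he', he', map_mul, Module.End.mul_apply]
    · apply Subtype.ext
      change e 1 = v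
      rw [he', map_one, Module.End.one_apply]

lemma card_adjoin_le (a : Module.End F V) :
    Nat.card (Algebra.adjoin F {a}) ≤ Fintype.card F ^ Module.finrank F V := by
  classical
  rw [Module.natCard_eq_pow_finrank (K := F), Nat.card_eq_fintype_card]
  apply Nat.pow_le_pow_right Fintype.card_pos
  have := Submodule.span_range_natDegree_eq_adjoin (LinearMap.charpoly_monic a)
    (LinearMap.aeval_self_charpoly a)
  change Module.finrank F (Subalgebra.toSubmodule (Algebra.adjoin F {a})) ≤ _
  rw [← this]
  refine (finrank_span_finset_le_card _).trans (Finset.card_image_le.trans ?_)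
  simp [LinearMap.charpoly_natDegree]

lemma exists_hom (h : Module.finrank F K = Module.finrank F V) [Nontrivial V]
    (a : (Module.End F V)ˣ) (ha : orderOf a = Fintype.card F ^ Module.finrank F V - 1) :
    ∃ (f : K →ₐ[F] Module.End F V) (u : Kˣ), Units.map (f : K →* Module.End F V) u = a := by
  classical
  set L := Algebra.adjoin F {(a : Module.End F V)} with hL
  haveI : Finite V := Module.finite_of_finite F
  haveI : Finite (Module.End F V) := Module.finite_of_finite F
  have hpos : 1 ≤ Fintype.card F ^ Module.finrank F V := Nat.one_le_pow _ _ Fintype.card_pos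
  have haL : (a : Module.End F V) ∈ L := Algebra.self_mem_adjoin_singleton F _
  -- the powers
  let g : Option (Subgroup.zpowers a) → L := fun o => o.elim 0 fun x =>
    ⟨((x : (Module.End F V)ˣ) : Module.End F V), by
      obtain ⟨n, hn⟩ := (isOfFinOrder_of_finite a).mem_powers_iff_mem_zpowers.2 x.2
      simp only at hn
      rw [← hn, Units.val_pow_eq_pow_val]
      exact pow_mem haL n⟩
  have hg : Function.Injective g := by
    rintro (_ | x) (_ | y) hxy
    · rfl
    · have := congrArg Subtype.val hxy
      exact absurd this.symm (Units.ne_zero _)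
    · have := congrArg Subtype.val hxy
      exact absurd this (Units.ne_zero _)
    · have := congrArg Subtype.val hxy
      exact congrArg some (Subtype.ext (Units.ext this))
  have hcard : Nat.card (Option (Subgroup.zpowers a)) = Fintype.card F ^ Module.finrank F V := by
    rw [Finite.card_option, Nat.card_zpowers, ha]; omega
  have hLc : Nat.card L = Fintype.card F ^ Module.finrank F V :=
    le_antisymm (card_adjoin_le _) (hcard ▸ Nat.card_le_card_of_injective g hg)
  have hgs : Function.Surjective g :=
    ((Nat.bijective_iff_injective_and_card g).2 ⟨hg, hcard.trans hLc.symm⟩).2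
  letI : CommRing L := Algebra.adjoinCommRingOfComm F (by simp)
  have hfield : IsField L := by
    refine ⟨⟨0, 1, zero_ne_one⟩, mul_comm, ?_⟩
    intro x hx
    obtain ⟨(_ | y), rfl⟩ := hgs x
    · exact absurd rfl hx
    · refine ⟨g (some y⁻¹), ?_⟩
      apply Subtype.ext
      change ((y : (Module.End F V)ˣ) : Module.End F V) * (((y⁻¹ : Subgroup.zpowers a) : (Module.End F V)ˣ) : Module.End F V) = 1
      simp
  letI : Field L := hfield.toField
  have hfr : Module.finrank F L = Module.finrank F V := by
    rw [Module.natCard_eq_pow_finrank (K := F), Nat.card_eq_fintype_card] at hLc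
    exact Nat.pow_right_injective Fintype.one_lt_card hLc
  obtain ⟨f⟩ : Nonempty (K →ₐ[F] L) :=
    FiniteField.nonempty_algHom_of_finrank_dvd (by rw [h, hfr])
  haveI : FiniteDimensional F K := Module.Finite.of_finite
  have hf : Function.Surjective f := by
    have := LinearMap.injective_iff_surjective_of_finrank_eq_finrank (f := f.toLinearMap)
      (h.trans hfr.symm)
    exact this.1 f.injective
  obtain ⟨k, hk⟩ := hf ⟨a, haL⟩
  have hk0 : k ≠ 0 := by
    rintro rfl
    rw [map_zero] at hk
    exact Units.ne_zero a (congrArg Subtype.val hk).symm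
  refine ⟨L.val.comp f, Units.mk0 k hk0, ?_⟩
  ext1
  simp [hk]

lemma units_map_inj [Nontrivial V] (f : K →ₐ[F] Module.End F V) :
    Function.Injective (Units.map (f : K →* Module.End F V)) :=
  Units.map_injective f.toRingHom.injective

lemma gen_pow (u : Kˣ) (hu : orderOf u = Nat.card K - 1) (k : K) (hk : k ≠ 0) :
    ∃ n : ℕ, k = (u : K) ^ n := by
  have h1 : Nat.card Kˣ = Nat.card K - 1 := Nat.card_units K
  have : Units.mk0 k hk ∈ Submonoid.powers u := by
    rw [(isOfFinOrder_of_finite u).mem_powers_iff_mem_zpowers]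
    rw [Subgroup.eq_top_of_card_eq (Subgroup.zpowers u) (by rw [Nat.card_zpowers, hu, h1])]
    trivial
  obtain ⟨n, hn⟩ := this
  refine ⟨n, ?_⟩
  have := congrArg Units.val hn
  simpa using this.symm

lemma card_fiber [Nontrivial V] (f₀ : K →ₐ[F] Module.End F V) (u₀ : Kˣ)
    (hu₀ : orderOf u₀ = Nat.card K - 1) :
    Nat.card {p : (K →ₐ[F] Module.End F V) × {u : Kˣ // orderOf u = Nat.card K - 1} //
      Units.map (p.1 : K →* Module.End F V) p.2.1 = Units.map (f₀ : K →* Module.End F V) u₀} =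
      Module.finrank F K := by
  haveI : FiniteDimensional F K := Module.Finite.of_finite
  rw [← IsGalois.card_aut_eq_finrank F K]
  symm
  let Φ : (K ≃ₐ[F] K) →
    {p : (K →ₐ[F] Module.End F V) × {u : Kˣ // orderOf u = Nat.card K - 1} //
      Units.map (p.1 : K →* Module.End F V) p.2.1 = Units.map (f₀ : K →* Module.End F V) u₀} :=
    fun σ => ⟨(f₀.comp σ.toAlgHom, ⟨Units.map (σ.symm : K →* K) u₀, by
      rw [orderOf_injective _ (Units.map_injective σ.symm.injective), hu₀]⟩), by
        ext1; simp⟩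
  refine Nat.card_eq_of_bijective Φ ⟨?_, ?_⟩
  · intro σ τ h
    have h1 : σ.symm (u₀ : K) = τ.symm (u₀ : K) :=
      congrArg (fun z => ((z.1.2.1 : Kˣ) : K)) h
    have h2 : σ.symm = τ.symm := by
      ext k
      by_cases hk : k = 0
      · simp [hk]
      · obtain ⟨n, rfl⟩ := gen_pow u₀ hu₀ k hk
        simp [h1]
    simpa using congrArg AlgEquiv.symm h2
  · rintro ⟨⟨f, u, hu⟩, h⟩
    simp only at h
    have h' : f (u : K) = f₀ (u₀ : K) := congrArg Units.val h
    have hr : ∀ k, f k ∈ f₀.range := by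
      intro k
      by_cases hk : k = 0
      · rw [hk, map_zero]; exact zero_mem _
      · obtain ⟨n, rfl⟩ := gen_pow u hu k hk
        exact ⟨(u₀ : K) ^ n, by rw [map_pow f, h']; simp⟩
    have hinj : Function.Injective f₀ := f₀.toRingHom.injective
    let ρ : K →ₐ[F] K := (AlgEquiv.ofInjective f₀ hinj).symm.toAlgHom.comp (f.codRestrict _ hr)
    have hρ : ∀ k, f₀ (ρ k) = f k := by
      intro k
      have : AlgEquiv.ofInjective f₀ hinj (ρ k) = f.codRestrict _ hr k := by
        simp [ρ]
      exact congrArg Subtype.val this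
    let σ : K ≃ₐ[F] K := AlgEquiv.ofBijective ρ
      ⟨ρ.injective, Finite.surjective_of_injective ρ.injective⟩
    have hσ : ∀ k, f₀ (σ k) = f k := hρ
    refine ⟨σ, ?_⟩
    apply Subtype.ext
    refine Prod.ext ?_ ?_
    · ext1 k
      exact hσ k
    · apply Subtype.ext
      ext1
      change σ.symm (u₀ : K) = u
      rw [AlgEquiv.symm_apply_eq]
      apply hinj
      rw [hσ, h']

lemma card_main [Nontrivial V] (h : Module.finrank F K = Module.finrank F V) :
    Module.finrank F V *
      Nat.card {a : (Module.End F V)ˣ // orderOf a = Fintype.card F ^ Module.finrank F V - 1} =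
    Nat.card (K →ₐ[F] Module.End F V) * Nat.totient (Fintype.card F ^ Module.finrank F V - 1) := by
  classical
  have hK : Nat.card K = Fintype.card F ^ Module.finrank F V := by
    rw [Module.natCard_eq_pow_finrank (K := F), Nat.card_eq_fintype_card, h]
  haveI : Finite V := Module.finite_of_finite F
  haveI : Finite (Module.End F V) := Module.finite_of_finite F
  haveI : Finite (K →ₐ[F] Module.End F V) := Finite.of_injective (fun f => (f : K → Module.End F V)) DFunLike.coe_injective
  letI := Fintype.ofFinite {a : (Module.End F V)ˣ // orderOf a = Fintype.card F ^ Module.finrank F V - 1}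
  rw [← hK] 
  have hgen : Nat.card {u : Kˣ // orderOf u = Nat.card K - 1} = Nat.totient (Nat.card K - 1) := by
    letI := Fintype.ofFinite Kˣ
    rw [← IsCyclic.card_orderOf_eq_totient (α := Kˣ) (d := Nat.card K - 1)
      (by rw [← Nat.card_eq_fintype_card, Nat.card_units])]
    rw [Nat.card_eq_fintype_card, Fintype.card_subtype]
  rw [← hgen, ← Nat.card_prod]
  let Ψ : (K →ₐ[F] Module.End F V) × {u : Kˣ // orderOf u = Nat.card K - 1} →
      {a : (Module.End F V)ˣ // orderOf a = Nat.card K - 1} := fun p =>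
    ⟨Units.map (p.1 : K →* Module.End F V) p.2.1, by
      rw [orderOf_injective _ (units_map_inj p.1), p.2.2]⟩
  letI := Fintype.ofFinite {a : (Module.End F V)ˣ // orderOf a = Nat.card K - 1}
  rw [← Nat.card_congr (Equiv.sigmaFiberEquiv Ψ), Nat.card_sigma]
  have : ∀ a, Nat.card {p // Ψ p = a} = Module.finrank F V := by
    rintro ⟨a, ha⟩
    obtain ⟨f, u, hfu⟩ := exists_hom (K := K) h a (by rw [ha, hK])
    have hu : orderOf u = Nat.card K - 1 := by
      rw [← ha, ← hfu, orderOf_injective _ (units_map_inj f)]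
    rw [← h, ← card_fiber f u hu]
    refine Nat.card_congr (Equiv.subtypeEquivRight fun p => ?_)
    rw [hfu, Subtype.ext_iff]
  rw [Finset.sum_congr rfl (fun a _ => this a)]
  simp [Nat.card_eq_fintype_card, mul_comm]

end
end Singer

/-- The number of Singer cycles in `GL_m(𝔽_q)` (elements of order `q^m - 1`) is
`(φ(q^m - 1)/m) ⬝ ∏_{i=1}^{m-1} (q^m - q^i)`. -/
theorem stmt_18 {F : Type*} [Field F] [Fintype F] (m : ℕ) (hm : 1 ≤ m) :
    Nat.card {A : GL (Fin m) F // orderOf A = Fintype.card F ^ m - 1} =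
      (Nat.totient (Fintype.card F ^ m - 1) / m) *
        ∏ i ∈ Finset.Ico 1 m, (Fintype.card F ^ m - Fintype.card F ^ i) := by
  classical
  haveI : NeZero m := ⟨by omega⟩
  obtain ⟨p, hp⟩ := CharP.exists F
  haveI : Fact p.Prime := ⟨CharP.char_is_prime F p⟩
  let K := FiniteField.Extension F p m
  have hK : Module.finrank F K = m := FiniteField.finrank_extension F p m
  have hV : Module.finrank F (Fin m → F) = m := by simp
  have hmain := Singer.card_main (K := K) (V := Fin m → F) (hK.trans hV.symm)
  rw [hV] at hmain
  let e : GL (Fin m) F ≃* (Module.End F (Fin m → F))ˣ := Matrix.GeneralLinearGroup.toLin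
  have hS : Nat.card {A : GL (Fin m) F // orderOf A = Fintype.card F ^ m - 1} =
      Nat.card {a : (Module.End F (Fin m → F))ˣ // orderOf a = Fintype.card F ^ m - 1} :=
    Nat.card_congr (e.toEquiv.subtypeEquiv fun A => by simp)
  have hE := Nat.card_congr (Singer.equiv1 (F := F) (K := K) (V := Fin m → F) (hK.trans hV.symm))
  haveI : FiniteDimensional F K := Module.Finite.of_finite
  let b : K ≃ₗ[F] (Fin m → F) := LinearEquiv.ofFinrankEq _ _ (hK.trans hV.symm)
  have hb : Nat.card (K ≃ₗ[F] (Fin m → F)) = Nat.card (GL (Fin m) F) := by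
    rw [Nat.card_congr e.toEquiv,
      Nat.card_congr (LinearMap.GeneralLinearGroup.generalLinearEquiv F (Fin m → F)).toEquiv]
    refine Nat.card_congr ⟨fun x => b.symm.trans x, fun y => b.trans y, fun x => ?_, fun y => ?_⟩
    · ext; simp
    · ext; simp
  have hq : 1 < Fintype.card F := Fintype.one_lt_card
  have hqm : 1 < Fintype.card F ^ m := Nat.one_lt_pow (by omega) hq
  have hv : Nat.card {v : Fin m → F // v ≠ 0} = Fintype.card F ^ m - 1 := by
    rw [Nat.card_eq_fintype_card, Fintype.card_subtype_compl]
    simp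
  rw [hb, Nat.card_prod, hv, Matrix.card_GL_field,
    Fin.prod_univ_eq_prod_range (fun i => Fintype.card F ^ m - Fintype.card F ^ i) m,
    Finset.range_eq_Ico, Finset.prod_eq_prod_Ico_succ_bot (by omega), pow_zero, mul_comm] at hE
  have hE' := Nat.eq_of_mul_eq_mul_right (by omega) hE
  rw [← hE'] at hmain
  rw [hS]
  obtain ⟨t, ht⟩ := Singer.dvd_totient (Fintype.card F) m hq hm
  rw [ht] at hmain ⊢
  rw [Nat.mul_div_cancel_left _ (by omega)]
  apply Nat.eq_of_mul_eq_mul_left (show 0 < m by omega)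
  rw [hmain]
  simp only [zero_add]
  ring
end
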